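/- arXiv:1506.02630 — 7 statements merged into one kernel-verified Lean document; each statement's English description precedes it below -/
import Mathlib

section
/- Let η ∈ ℂ, η ≠ 0, let ξ_1,…,ξ_N ∈ ℂ, and set a(λ) = ∏_{n=1}^{N}(λ − ξ_n + η) and d(λ) = ∏_{n=1}^{N}(λ − ξ_n). Let τ : ℂ → ℂ be any function, and suppose P and Q are monic polynomials with complex coefficients such that τ(λ)·Q(λ) = −a(λ)·Q(λ−η) + d(λ)·Q(λ+η) and τ(λ)·P(λ) = −a(λ)·P(λ−η) + d(λ)·P(λ+η) hold for all λ ∈ ℂ. Then P = Q. -/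
open Finset

open Polynomial in
/-- A polynomial `W` with `W / D` antiperiodic under a shift vanishes. -/
theorem eq_zero_of_taylor_mul_add_mul_taylor {K : Type*} [Field K] [CharZero K] {D W : K[X]}
    (r : K) (hD : D ≠ 0) (h : taylor r D * W + D * taylor r W = 0) : W = 0 := by
  have h1 := coeff_mul_degree_add_degree (taylor r D) W
  have h2 := coeff_mul_degree_add_degree D (taylor r W)
  have hc := congrArg (fun p => p.coeff (D.natDegree + W.natDegree)) h
  simp only [natDegree_taylor, leadingCoeff_taylor] at h1 h2
  simp only [coeff_add, h1, h2, coeff_zero, ← two_mul] at hc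
  simpa [hD] using hc

open Polynomial in
/-- If `P / Q` is periodic under the shift by `r`, it is periodic under all multiples of `r`. -/
theorem taylor_nsmul_mul_eq {K : Type*} [Field K] {P Q : K[X]} (r : K) (hQ : Q ≠ 0)
    (h : taylor r P * Q = P * taylor r Q) (n : ℕ) :
    taylor (n * r) P * Q = P * taylor (n * r) Q := by
  induction n with
  | zero => simp
  | succ n ih =>
    have h' := congrArg (taylor (n * r)) h
    simp only [taylor_mul, taylor_taylor] at h'
    have hs : ((n + 1 : ℕ) : K) * r = n * r + r := by push_cast; ring
    have hQn : taylor (n * r) Q ≠ 0 := by simpa using hQ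
    rw [hs]
    refine mul_right_cancel₀ hQn ?_
    linear_combination Q * h' + taylor (n * r + r) Q * ih

open Polynomial in
/-- Monic polynomials whose quotient is periodic under a nonzero shift are equal. -/
theorem Polynomial.Monic.eq_of_taylor_mul_eq {K : Type*} [Field K] [CharZero K] {P Q : K[X]}
    {r : K} (hr : r ≠ 0) (hP : P.Monic) (hQ : Q.Monic)
    (h : taylor r P * Q = P * taylor r Q) : P = Q := by
  obtain ⟨x, hx⟩ : ∃ x, Q.eval x ≠ 0 := by
    by_contra! hx
    exact hQ.ne_zero (Polynomial.funext fun x => by simpa using hx x)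
  have hinj : Function.Injective fun n : ℕ => x + n * r := fun m n hmn => by
    simpa [hr] using hmn
  have hprop : C (Q.eval x) * P = C (P.eval x) * Q := by
    refine eq_of_infinite_eval_eq _ _ ((Set.infinite_range_of_injective hinj).mono ?_)
    rintro _ ⟨n, rfl⟩
    have hn := congrArg (eval x) (taylor_nsmul_mul_eq r hQ.ne_zero h n)
    simp only [eval_mul, taylor_eval] at hn
    simp only [Set.mem_ofPred_eq, eval_mul, eval_C]
    rw [mul_comm, hn]
  have hlc : Q.eval x = P.eval x := by
    simpa [hP.leadingCoeff, hQ.leadingCoeff] using congrArg Polynomial.leadingCoeff hprop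
  rw [← hlc] at hprop
  exact mul_left_cancel₀ (C_ne_zero.mpr hx) hprop

theorem statement1 (N : ℕ) (η : ℂ) (hη : η ≠ 0) (ξ : Fin N → ℂ)
    (τ : ℂ → ℂ) (P Q : Polynomial ℂ) (hP : P.Monic) (hQ : Q.Monic)
    (hQeq : ∀ lam : ℂ, τ lam * Q.eval lam =
      -(∏ n, (lam - ξ n + η)) * Q.eval (lam - η) +
        (∏ n, (lam - ξ n)) * Q.eval (lam + η))
    (hPeq : ∀ lam : ℂ, τ lam * P.eval lam =
      -(∏ n, (lam - ξ n + η)) * P.eval (lam - η) +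
        (∏ n, (lam - ξ n)) * P.eval (lam + η)) :
    P = Q := by
  let D : Polynomial ℂ := ∏ n, (Polynomial.X - Polynomial.C (ξ n))
  have hD : D ≠ 0 :=
    (Polynomial.monic_prod_of_monic _ _ fun n _ => Polynomial.monic_X_sub_C (ξ n)).ne_zero
  have hDeval (x : ℂ) : D.eval x = ∏ n, (x - ξ n) := by simp [D, Polynomial.eval_prod]
  let W : Polynomial ℂ := Q * Polynomial.taylor (-η) P - P * Polynomial.taylor (-η) Q
  have hW : W = 0 := by
    refine eq_zero_of_taylor_mul_add_mul_taylor η hD (Polynomial.funext fun x => ?_)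
    have ha : ∏ n, (x + η - ξ n) = ∏ n, (x - ξ n + η) :=
      Finset.prod_congr rfl fun n _ => by ring
    simp only [W, Polynomial.eval_add, Polynomial.eval_mul, Polynomial.eval_sub,
      Polynomial.taylor_eval, Polynomial.eval_zero, hDeval, ha, ← sub_eq_add_neg,
      add_sub_cancel_right]
    linear_combination Q.eval x * hPeq x - P.eval x * hQeq x
  refine hP.eq_of_taylor_mul_eq (neg_ne_zero.mpr hη) hQ ?_
  linear_combination hW
end

section
/- Let η ∈ ℂ and let p, q, d be polynomials with complex coefficients such that (1/2)·[p(λ)q(λ−η) + q(λ)p(λ−η)] = d(λ) for all λ ∈ ℂ. Set a(λ) = d(λ+η) and define τ^{(±)}(λ) = ±(1/2)·[p(λ−η)q(λ+η) − q(λ−η)p(λ+η)]. Then for all λ ∈ ℂ: τ^{(±)}(λ)·q(λ) = ±[d(λ)·q(λ+η) − a(λ)·q(λ−η)] and τ^{(±)}(λ)·p(λ) = ∓[d(λ)·p(λ+η) − a(λ)·p(λ−η)]. In particular τ^{(+)} = −τ^{(−)} satisfies Baxter's T-Q equation τ(λ)q(λ) = −a(λ)q(λ−η) + d(λ)q(λ+η)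 with q, while τ^{(−)} satisfies the same equation with p in place of q. -/
theorem statement2 (η : ℂ) (p q d : Polynomial ℂ)
    (hW : ∀ lam : ℂ,
      (1 / 2 : ℂ) * (p.eval lam * q.eval (lam - η) + q.eval lam * p.eval (lam - η))
        = d.eval lam) :
    ∀ lam : ℂ,
      ((1 / 2 : ℂ) * (p.eval (lam - η) * q.eval (lam + η)
          - q.eval (lam - η) * p.eval (lam + η))) * q.eval lam
        = d.eval lam * q.eval (lam + η) - d.eval (lam + η) * q.eval (lam - η)
      ∧ ((1 / 2 : ℂ) * (p.eval (lam - η) * q.eval (lam + η)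
          - q.eval (lam - η) * p.eval (lam + η))) * p.eval lam
        = -(d.eval lam * p.eval (lam + η) - d.eval (lam + η) * p.eval (lam - η))
      ∧ (-((1 / 2 : ℂ) * (p.eval (lam - η) * q.eval (lam + η)
          - q.eval (lam - η) * p.eval (lam + η)))) * q.eval lam
        = -(d.eval lam * q.eval (lam + η) - d.eval (lam + η) * q.eval (lam - η))
      ∧ (-((1 / 2 : ℂ) * (p.eval (lam - η) * q.eval (lam + η)
          - q.eval (lam - η) * p.eval (lam + η)))) * p.eval lam
        = d.eval lam * p.eval (lam + η) - d.eval (lam + η) * p.eval (lam - η) := by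
  intro lam
  have shifted := hW (lam + η)
  rw [add_sub_cancel_right] at shifted
  rw [← hW lam, ← shifted]
  refine ⟨?_, ?_, ?_, ?_⟩ <;> ring
end

section
/- Let η ∈ ℂ, η ≠ 0, and let x_1,…,x_M be pairwise distinct complex numbers with x_a − x_b ≠ ±η for all a, b. Then for any complex numbers f_1,…,f_M one has 𝒜^{+}_{x}[f] = 𝒜^{−}_{x}[g] and 𝒜^{−}_{x}[f] = 𝒜^{+}_{x}[h], where g_a = −f_a·∏_{m=1}^{M}(x_a − x_m + η)/(x_a − x_m − η) and h_a = −f_a·∏_{m=1}^{M}(x_a − x_m − η)/(x_a − x_m + η). -/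
open Finset

/-- Vandermonde product `V(x) = ∏_{1 ≤ b < a ≤ M} (x_a - x_b)`. -/
noncomputable def Vprod {M : ℕ} (x : Fin M → ℂ) : ℂ :=
  ∏ a, ∏ b ∈ Finset.univ.filter (fun b => b < a), (x a - x b)

/-- The functional `𝒜^{ε}_{x}[f] = det[ x_a^{b-1} - f_a (x_a + ε)^{b-1} ] / V(x)`,
where `ε = η` gives `𝒜^{+}` and `ε = -η` gives `𝒜^{-}`, and `f` is given by its
values `f_a` at the points `x_a`. -/
noncomputable def Afun' {M : ℕ} (x : Fin M → ℂ) (f : Fin M → ℂ) (ε : ℂ) : ℂ :=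
  Matrix.det (Matrix.of fun a b : Fin M =>
    x a ^ (b : ℕ) - f a * (x a + ε) ^ (b : ℕ)) / Vprod x

/-- The matrix of Lagrange basis polynomials at the nodes `x`, evaluated at the shifted nodes
`x a + ε`. -/
noncomputable def lagrangeShift {M : ℕ} (x : Fin M → ℂ) (ε : ℂ) : Matrix (Fin M) (Fin M) ℂ :=
  Matrix.of fun a b => (Lagrange.basis Finset.univ x b).eval (x a + ε)

theorem lagrangeShift_mul_vandermonde {M : ℕ} {x : Fin M → ℂ} (hx : Function.Injective x)
    (ε : ℂ) :
    lagrangeShift x ε * Matrix.vandermonde x = Matrix.vandermonde fun a => x a + ε := by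
  ext a k
  have h := Lagrange.eq_interpolate (s := Finset.univ) (v := x)
    (f := (Polynomial.X : Polynomial ℂ) ^ (k : ℕ)) hx.injOn (by
      rw [Polynomial.degree_X_pow, Finset.card_univ, Fintype.card_fin]
      exact_mod_cast k.isLt)
  have h' := congrArg (Polynomial.eval (x a + ε)) h
  simp only [Lagrange.interpolate_apply, Polynomial.eval_finsetSum, Polynomial.eval_mul,
    Polynomial.eval_C, Polynomial.eval_pow, Polynomial.eval_X] at h'
  simp only [lagrangeShift, Matrix.mul_apply, Matrix.of_apply, Matrix.vandermonde_apply]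
  rw [h']
  exact Finset.sum_congr rfl fun b _ => mul_comm _ _

theorem lagrangeShift_eq_diagonal_mul_cauchy {M : ℕ} (x : Fin M → ℂ) {ε : ℂ}
    (hε : ∀ a b, x a - x b + ε ≠ 0) :
    lagrangeShift x ε =
      Matrix.diagonal (fun a => ∏ m, (x a - x m + ε)) *
        Matrix.of (fun a b => (x a - x b + ε)⁻¹) *
        Matrix.diagonal (fun b => ∏ m ∈ Finset.univ.erase b, (x b - x m)⁻¹) := by
  ext a b
  rw [Matrix.mul_diagonal, Matrix.diagonal_mul, Matrix.of_apply,
    ← Finset.mul_prod_erase _ _ (Finset.mem_univ b), mul_comm (x a - x b + ε),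
    mul_inv_cancel_right₀ (hε a b), ← Finset.prod_mul_distrib]
  simp only [lagrangeShift, Matrix.of_apply, Lagrange.basis, Lagrange.basisDivisor,
    Polynomial.eval_prod, Polynomial.eval_mul, Polynomial.eval_C, Polynomial.eval_sub,
    Polynomial.eval_X]
  exact Finset.prod_congr rfl fun m _ => by ring

theorem det_sub_shift_eq {M : ℕ} {x : Fin M → ℂ} (hx : Function.Injective x) (f : Fin M → ℂ)
    (ε : ℂ) :
    Matrix.det (Matrix.of fun a b : Fin M => x a ^ (b : ℕ) - f a * (x a + ε) ^ (b : ℕ)) =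
      (1 - Matrix.diagonal f * lagrangeShift x ε).det * (Matrix.vandermonde x).det := by
  rw [← Matrix.det_mul, Matrix.sub_mul, Matrix.one_mul, Matrix.mul_assoc,
    lagrangeShift_mul_vandermonde hx]
  congr 1
  ext a b
  simp [Matrix.diagonal_mul, Matrix.vandermonde_apply]

theorem det_one_sub_diagonal_mul_transpose {n R : Type*} [Fintype n] [DecidableEq n] [CommRing R]
    (u v : n → R) (C : Matrix n n R) :
    (1 - Matrix.diagonal u * C.transpose * Matrix.diagonal v).det =
      (1 - Matrix.diagonal u * C * Matrix.diagonal v).det := by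
  rw [← Matrix.det_transpose, Matrix.det_one_sub_mul_comm (Matrix.diagonal u * C)]
  simp only [Matrix.transpose_sub, Matrix.transpose_one, Matrix.transpose_mul,
    Matrix.diagonal_transpose, Matrix.transpose_transpose]
  rw [← Matrix.mul_assoc, Matrix.det_one_sub_mul_comm, ← Matrix.mul_assoc, ← Matrix.mul_assoc,
    Matrix.diagonal_mul_diagonal, Matrix.diagonal_mul_diagonal]
  simp only [mul_comm]

theorem Afun'_eq_Afun'_neg {M : ℕ} {x : Fin M → ℂ} (hx : Function.Injective x) {ε : ℂ}
    (hε : ∀ a b, x a - x b + ε ≠ 0) (f : Fin M → ℂ) :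
    Afun' x f ε =
      Afun' x (fun a => -f a * ∏ m, (x a - x m + ε) / (x a - x m - ε)) (-ε) := by
  have hneg : ∀ a b, x a - x b + -ε ≠ 0 := fun a b h =>
    hε b a (by linear_combination -h)
  unfold Afun'
  rw [det_sub_shift_eq hx, det_sub_shift_eq hx, lagrangeShift_eq_diagonal_mul_cauchy x hε,
    lagrangeShift_eq_diagonal_mul_cauchy x hneg]
  simp only [← Matrix.mul_assoc, Matrix.diagonal_mul_diagonal]
  rw [← det_one_sub_diagonal_mul_transpose]
  congr 5
  ext a b
  rw [Matrix.diagonal_mul, Matrix.diagonal_mul, Matrix.transpose_apply, Matrix.of_apply,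
    Matrix.of_apply, Finset.prod_div_distrib]
  have hprod : ∏ m, (x a - x m - ε) ≠ 0 :=
    Finset.prod_ne_zero_iff.mpr fun m _ => by simpa [sub_eq_add_neg] using hneg a m
  have hinv : (x a - x b + -ε)⁻¹ = -(x b - x a + ε)⁻¹ := by
    rw [← inv_neg]
    congr 1
    ring
  rw [hinv]
  simp only [← sub_eq_add_neg]
  field_simp

theorem statement3 (M : ℕ) (η : ℂ) (hη : η ≠ 0) (x : Fin M → ℂ)
    (hx : Function.Injective x)
    (hxη : ∀ a b : Fin M, x a - x b ≠ η ∧ x a - x b ≠ -η)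
    (f : Fin M → ℂ) :
    Afun' x f η
      = Afun' x (fun a => -f a * ∏ m, (x a - x m + η) / (x a - x m - η)) (-η)
    ∧ Afun' x f (-η)
      = Afun' x (fun a => -f a * ∏ m, (x a - x m - η) / (x a - x m + η)) η := by
  refine ⟨Afun'_eq_Afun'_neg hx (fun a b h => (hxη a b).2 (by linear_combination h)) f, ?_⟩
  have h := Afun'_eq_Afun'_neg hx (ε := -η)
    (fun a b h => (hxη a b).1 (by linear_combination h)) f
  simpa only [neg_neg, ← sub_eq_add_neg, sub_neg_eq_add] using h
end

section
/- Let η ∈ ℂ, η ≠ 0, let μ ∈ ℂ, and let x = (x_1,…,x_N) and y = (y_1,…,y_N) be tuples of complex numbers, each pairwise distinct, with x_a − y_b ∉ {0, −η} for all a, b. Then the generalized Izergin determinant satisfies ℐ^{(μ)}_N(x, y) = (−1)^N·𝒜^{−}_{x}[μE^{+}_{y}] = (−1)^N·𝒜^{+}_{y}[μE^{−}_{x}]. -/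
open Finset

/-- Reversed Vandermonde product `V(y_M, …, y_1) = ∏_{1 ≤ b < a ≤ M} (y_b - y_a)`. -/
noncomputable def VprodRev {M : ℕ} (y : Fin M → ℂ) : ℂ :=
  ∏ a, ∏ b ∈ Finset.univ.filter (fun b => b < a), (y b - y a)

/-- The functional `𝒜^{ε}_{x}[f] = det[ x_a^{b-1} - f(x_a) (x_a + ε)^{b-1} ] / V(x)`;
`ε = η` gives `𝒜^{+}` and `ε = -η` gives `𝒜^{-}`. -/
noncomputable def Afun {M : ℕ} (x : Fin M → ℂ) (f : ℂ → ℂ) (ε : ℂ) : ℂ :=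
  Matrix.det (Matrix.of fun a b : Fin M =>
    x a ^ (b : ℕ) - f (x a) * (x a + ε) ^ (b : ℕ)) / Vprod x

/-- `E^{ε}_{x}(z) = ∏_{n} (z - x_n + ε)/(z - x_n)`; `ε = η` gives `E^{+}` and
`ε = -η` gives `E^{-}`. -/
noncomputable def Efun {M : ℕ} (x : Fin M → ℂ) (ε : ℂ) (z : ℂ) : ℂ :=
  ∏ n, (z - x n + ε) / (z - x n)

/-- The generalized Izergin determinant
`ℐ^{(μ)}_N(x,y) = ∏_{a,b}(x_a - y_b + η) / (V(x) V(y_N,…,y_1)) · det[ t_μ(x_a - y_b) ]`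
with `t_μ(z) = μ/z - 1/(z+η)`. -/
noncomputable def Izergin {N : ℕ} (η μ : ℂ) (x y : Fin N → ℂ) : ℂ :=
  (∏ a, ∏ b, (x a - y b + η)) / (Vprod x * VprodRev y) *
    Matrix.det (Matrix.of fun a b : Fin N =>
      μ / (x a - y b) - 1 / (x a - y b + η))

/-- `Vprod` is the determinant of the Vandermonde matrix. -/
theorem Vprod_eq_det_vandermonde {M : ℕ} (x : Fin M → ℂ) :
    Vprod x = (Matrix.vandermonde x).det := by
  rw [Matrix.det_vandermonde, Vprod]
  exact Finset.prod_comm' (by simp)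

theorem Vprod_ne_zero {M : ℕ} {x : Fin M → ℂ} (hx : Function.Injective x) : Vprod x ≠ 0 := by
  rw [Vprod_eq_det_vandermonde]
  exact Matrix.det_vandermonde_ne_zero_iff.mpr hx

theorem VprodRev_eq_Vprod_neg {M : ℕ} (y : Fin M → ℂ) :
    VprodRev y = Vprod (fun a => -y a) := by
  simp only [VprodRev, Vprod]
  refine Finset.prod_congr rfl fun a _ => Finset.prod_congr rfl fun b _ => ?_
  ring

theorem VprodRev_ne_zero {M : ℕ} {y : Fin M → ℂ} (hy : Function.Injective y) :
    VprodRev y ≠ 0 := by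
  rw [VprodRev_eq_Vprod_neg]
  exact Vprod_ne_zero (neg_injective.comp hy)

theorem Vprod_sub_const {M : ℕ} (y : Fin M → ℂ) (c : ℂ) :
    Vprod (fun a => y a - c) = Vprod y := by
  simp [Vprod]

theorem VprodRev_sub_const {M : ℕ} (y : Fin M → ℂ) (c : ℂ) :
    VprodRev (fun a => y a - c) = VprodRev y := by
  simp [VprodRev]

theorem Vprod_neg {M : ℕ} (y : Fin M → ℂ) :
    Vprod (fun a => -y a) = (∏ a : Fin M, (-1 : ℂ) ^ (a : ℕ)) * Vprod y := by
  have h := Matrix.det_mul_row (fun b : Fin M => (-1 : ℂ) ^ (b : ℕ)) (Matrix.vandermonde y)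
  rw [Vprod_eq_det_vandermonde, Vprod_eq_det_vandermonde, ← h]
  congr 1
  ext a b
  simp [Matrix.vandermonde_apply, neg_pow (y a)]

/-- The product of all ordered differences of a tuple splits into the two Vandermonde products. -/
theorem prod_prod_erase_sub {M : ℕ} (w : Fin M → ℂ) :
    ∏ b, ∏ c ∈ Finset.univ.erase b, (w b - w c) = Vprod w * VprodRev w := by
  have h : VprodRev w = ∏ b, ∏ c ∈ Finset.univ.filter (fun c => b < c), (w b - w c) :=
    Finset.prod_comm' (by simp)
  rw [h, Vprod, ← Finset.prod_mul_distrib]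
  refine Finset.prod_congr rfl fun b _ => ?_
  rw [← Finset.prod_union (Finset.disjoint_filter.mpr fun c _ h₁ h₂ => lt_asymm h₁ h₂)]
  refine Finset.prod_congr ?_ fun _ _ => rfl
  ext c
  simp [or_comm, eq_comm]

/-- The nodal polynomial of the tuple `w` with the `b`-th root left out. -/
noncomputable def nodalErase {N : ℕ} (w : Fin N → ℂ) (b : Fin N) : Polynomial ℂ :=
  ∏ c ∈ Finset.univ.erase b, (Polynomial.X - Polynomial.C (w c))

theorem eval_nodalErase {N : ℕ} (w : Fin N → ℂ) (b : Fin N) (z : ℂ) :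
    (nodalErase w b).eval z = ∏ c ∈ Finset.univ.erase b, (z - w c) := by
  simp [nodalErase, Polynomial.eval_prod]

theorem eval_nodalErase_eq_sum {N : ℕ} (w : Fin N → ℂ) (b : Fin N) (z : ℂ) :
    (nodalErase w b).eval z = ∑ k : Fin N, z ^ (k : ℕ) * (nodalErase w b).coeff k := by
  have hd : (nodalErase w b).natDegree < N := by
    rw [nodalErase, Polynomial.natDegree_finsetProd_X_sub_C_eq_card,
      Finset.card_erase_of_mem (Finset.mem_univ b), Finset.card_univ, Fintype.card_fin]
    have := b.pos
    omega
  rw [Polynomial.eval_eq_sum_range' hd, Finset.sum_range]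
  exact Finset.sum_congr rfl fun _ _ => mul_comm _ _

theorem det_coeff_nodalErase {N : ℕ} {w : Fin N → ℂ} (hw : Function.Injective w) :
    (Matrix.of fun k b : Fin N => (nodalErase w b).coeff k).det = VprodRev w := by
  have h : Matrix.vandermonde w * (Matrix.of fun k b : Fin N => (nodalErase w b).coeff k) =
      Matrix.diagonal fun b => ∏ c ∈ Finset.univ.erase b, (w b - w c) := by
    ext a b
    rw [Matrix.mul_apply]
    simp only [Matrix.vandermonde_apply, Matrix.of_apply]
    rw [← eval_nodalErase_eq_sum, eval_nodalErase]
    rcases eq_or_ne a b with rfl | hab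
    · rw [Matrix.diagonal_apply_eq]
    · rw [Matrix.diagonal_apply_ne _ hab]
      exact Finset.prod_eq_zero (Finset.mem_erase.mpr ⟨hab, Finset.mem_univ a⟩) (sub_self _)
  have h' := congrArg Matrix.det h
  rw [Matrix.det_mul, Matrix.det_diagonal, prod_prod_erase_sub, ← Vprod_eq_det_vandermonde] at h'
  exact mul_left_cancel₀ (Vprod_ne_zero hw) h'

theorem Izergin_eq_Afun_left {N : ℕ} (η μ : ℂ) (x y : Fin N → ℂ)
    (hy : Function.Injective y) (hxy : ∀ a b : Fin N, x a - y b ≠ 0 ∧ x a - y b ≠ -η) :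
    Izergin η μ x y = (-1 : ℂ) ^ N * Afun x (fun z => μ * Efun y η z) (-η) := by
  set w : Fin N → ℂ := fun b => y b - η with hw
  have hwinj : Function.Injective w := fun a b h => hy (sub_left_injective h)
  have hrow : (∏ a, ∏ b, (x a - y b + η)) * Matrix.det (Matrix.of fun a b : Fin N =>
        μ / (x a - y b) - 1 / (x a - y b + η)) =
      (-1 : ℂ) ^ N * (Matrix.det (Matrix.of fun a b : Fin N =>
        x a ^ (b : ℕ) - μ * Efun y η (x a) * (x a + -η) ^ (b : ℕ)) * VprodRev y) := by
    rw [← VprodRev_sub_const y η, ← det_coeff_nodalErase hwinj, ← Matrix.det_mul,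
      ← Matrix.det_mul_column]
    have hneg := Matrix.det_neg ((Matrix.of fun a b : Fin N =>
        x a ^ (b : ℕ) - μ * Efun y η (x a) * (x a + -η) ^ (b : ℕ)) *
      Matrix.of fun k b : Fin N => (nodalErase w b).coeff k)
    rw [Fintype.card_fin] at hneg
    rw [← hneg]
    congr 1
    ext a b
    have hsum : ∑ k : Fin N, (x a ^ (k : ℕ) - μ * Efun y η (x a) * (x a + -η) ^ (k : ℕ)) *
          (nodalErase w b).coeff k =
        (nodalErase w b).eval (x a) - μ * Efun y η (x a) * (nodalErase w b).eval (x a + -η) := by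
      rw [eval_nodalErase_eq_sum, eval_nodalErase_eq_sum, Finset.mul_sum,
        ← Finset.sum_sub_distrib]
      exact Finset.sum_congr rfl fun _ _ => by ring
    rw [Matrix.neg_apply, Matrix.mul_apply]
    simp only [Matrix.of_apply]
    rw [hsum, eval_nodalErase, eval_nodalErase, Efun, Finset.prod_div_distrib]
    have h₁ : ∏ c ∈ Finset.univ.erase b, (x a - w c) =
        ∏ c ∈ Finset.univ.erase b, (x a - y c + η) :=
      Finset.prod_congr rfl fun c _ => by simp only [hw]; ring
    have h₂ : ∏ c ∈ Finset.univ.erase b, (x a + -η - w c) =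
        ∏ c ∈ Finset.univ.erase b, (x a - y c) :=
      Finset.prod_congr rfl fun c _ => by simp only [hw]; ring
    rw [h₁, h₂, ← Finset.mul_prod_erase _ (fun c => x a - y c + η) (Finset.mem_univ b),
      ← Finset.mul_prod_erase _ (fun c => x a - y c) (Finset.mem_univ b)]
    have hb : x a - y b ≠ 0 := (hxy a b).1
    have hb' : x a - y b + η ≠ 0 := fun h => (hxy a b).2 (eq_neg_of_add_eq_zero_left h)
    have hp : ∏ c ∈ Finset.univ.erase b, (x a - y c) ≠ 0 :=
      Finset.prod_ne_zero_iff.mpr fun c _ => (hxy a c).1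
    generalize ∏ c ∈ Finset.univ.erase b, (x a - y c) = p at hp ⊢
    generalize ∏ c ∈ Finset.univ.erase b, (x a - y c + η) = q
    field_simp
    ring
  rw [Izergin, Afun, div_mul_eq_mul_div, hrow, ← mul_assoc,
    mul_div_mul_right _ _ (VprodRev_ne_zero hy), mul_div_assoc]

theorem Izergin_neg_swap {N : ℕ} (η μ : ℂ) (x y : Fin N → ℂ) :
    Izergin η μ (fun a => -y a) (fun a => -x a) = Izergin η μ x y := by
  have hV : Vprod (fun a => -y a) * VprodRev (fun a => -x a) = Vprod x * VprodRev y := by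
    simp only [VprodRev_eq_Vprod_neg, neg_neg]
    ring
  have hsub : ∀ a b : Fin N, -y a - -x b = x b - y a := fun a b => by ring
  rw [Izergin, Izergin, hV]
  simp only [hsub]
  rw [Finset.prod_comm, ← Matrix.det_transpose]
  rfl

theorem Afun_neg {M : ℕ} (y : Fin M → ℂ) (f : ℂ → ℂ) (ε : ℂ) :
    Afun (fun a => -y a) f (-ε) = Afun y (fun z => f (-z)) ε := by
  have h := Matrix.det_mul_row (fun b : Fin M => (-1 : ℂ) ^ (b : ℕ))
    (Matrix.of fun a b : Fin M => y a ^ (b : ℕ) - f (-y a) * (y a + ε) ^ (b : ℕ))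
  have hs : ∏ a : Fin M, (-1 : ℂ) ^ (a : ℕ) ≠ 0 :=
    Finset.prod_ne_zero_iff.mpr fun a _ => pow_ne_zero _ (by norm_num)
  rw [Afun, Afun, Vprod_neg, ← mul_div_mul_left _ (Vprod y) hs, ← h]
  congr 2
  ext a b
  simp only [Matrix.of_apply]
  rw [← neg_add, neg_pow (y a), neg_pow (y a + ε)]
  ring

theorem Efun_neg {M : ℕ} (x : Fin M → ℂ) (ε z : ℂ) :
    Efun (fun a => -x a) ε (-z) = Efun x (-ε) z := by
  refine Finset.prod_congr rfl fun n _ => ?_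
  rw [← neg_div_neg_eq]
  congr 1 <;> ring

theorem statement4 (N : ℕ) (η : ℂ) (hη : η ≠ 0) (μ : ℂ)
    (x y : Fin N → ℂ) (hx : Function.Injective x) (hy : Function.Injective y)
    (hxy : ∀ a b : Fin N, x a - y b ≠ 0 ∧ x a - y b ≠ -η) :
    Izergin η μ x y = (-1 : ℂ) ^ N * Afun x (fun z => μ * Efun y η z) (-η)
    ∧ Izergin η μ x y = (-1 : ℂ) ^ N * Afun y (fun z => μ * Efun x (-η) z) η := by
  refine ⟨Izergin_eq_Afun_left η μ x y hy hxy, ?_⟩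
  rw [← Izergin_neg_swap, Izergin_eq_Afun_left η μ (fun a => -y a) (fun a => -x a)
    (neg_injective.comp hx), Afun_neg]
  · simp only [Efun_neg]
  · intro a b
    rw [neg_sub_neg]
    exact hxy b a
end

section
/- Let η ∈ ℂ, η ≠ 0. Let x = (x_1,…,x_M) and y = (y_1,…,y_N) be tuples of complex numbers, each pairwise distinct, with x_a ≠ y_b for all a, b, and suppose N > M. Then 𝒜^{+}_{y}[E^{−}_{x}] = 0 and 𝒜^{−}_{y}[E^{+}_{x}] = 0. -/
open Finset

open Polynomial in
/-- The shifted polynomial `∏ n, (z - x n - ε)` gives a kernel vector of the matrix. -/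
theorem Afun_Efun_neg_eq_zero {M N : ℕ} (ε : ℂ) (x : Fin M → ℂ) (y : Fin N → ℂ)
    (hxy : ∀ (a : Fin M) (b : Fin N), x a ≠ y b) (hNM : M < N) :
    Afun y (fun z => Efun x (-ε) z) ε = 0 := by
  set q : ℂ[X] := ∏ n, (X - C (x n + ε)) with hq
  have hmonic : q.Monic := monic_prod_X_sub_C _ _
  have hdeg : q.natDegree = M := by
    rw [hq, natDegree_finsetProd_X_sub_C_eq_card, Finset.card_univ, Fintype.card_fin]
  have heval (z : ℂ) : q.eval z = ∑ b : Fin N, z ^ (b : ℕ) * q.coeff b := by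
    rw [eval_eq_sum_range' (hdeg.trans_lt hNM), Finset.sum_range]
    simp only [mul_comm]
  unfold Afun
  rw [Matrix.exists_mulVec_eq_zero_iff.mp, zero_div]
  refine ⟨fun b => q.coeff b, fun h => ?_, ?_⟩
  · have hcoeff := congrFun h ⟨M, hNM⟩
    have hlead := hmonic.coeff_natDegree
    rw [hdeg] at hlead
    simp [hlead] at hcoeff
  · ext a
    have hprod : ∏ n, (y a - x n) ≠ 0 :=
      Finset.prod_ne_zero_iff.mpr fun n _ => sub_ne_zero.mpr (hxy n a).symm
    simp only [Matrix.mulVec, dotProduct, Matrix.of_apply, sub_mul, mul_assoc,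
      Finset.sum_sub_distrib, ← Finset.mul_sum, ← heval, Pi.zero_apply]
    have hshift : q.eval (y a + ε) = ∏ n, (y a - x n) := by
      simp [hq, eval_prod]
    have hself : q.eval (y a) = ∏ n, (y a - x n + -ε) := by
      rw [hq, eval_prod]
      refine Finset.prod_congr rfl fun n _ => ?_
      simp only [eval_sub, eval_X, eval_C]
      ring
    rw [hshift, hself, Efun, Finset.prod_div_distrib, div_mul_cancel₀ _ hprod, sub_self]

theorem statement6 (M N : ℕ) (η : ℂ) (hη : η ≠ 0)
    (x : Fin M → ℂ) (y : Fin N → ℂ)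
    (hx : Function.Injective x) (hy : Function.Injective y)
    (hxy : ∀ (a : Fin M) (b : Fin N), x a ≠ y b)
    (hNM : N > M) :
    Afun y (fun z => Efun x (-η) z) η = 0
    ∧ Afun y (fun z => Efun x η z) (-η) = 0 := by
  refine ⟨Afun_Efun_neg_eq_zero η x y hxy hNM, ?_⟩
  simpa only [neg_neg] using Afun_Efun_neg_eq_zero (-η) x y hxy hNM
end

section
/- Let η ∈ ℂ and let x_1,…,x_M be complex numbers. Set Q(λ) = ∏_{j=1}^{M}(λ − x_j) and Q_k(λ) = ∏_{j≠k}(λ − x_j). Define the 2M×2M matrix 𝒞 by requiring, as polynomial identities in λ, Q_k(λ)·Q_k(λ+η) = Σ_{a=1}^{2M} 𝒞_{k,a}·λ^{a−1} and Q_k(λ)·Q(λ+η) = Σ_{a=1}^{2M} 𝒞_{k+M,a}·λ^{a−1} for 1 ≤ k ≤ M. Then det 𝒞 = (−1)^{M(M−1)/2}·∏_{k=1}^{M} Q_k(x_k)·Q_k(x_k+η). -/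
open Finset

section CoefficientMatrix

open Polynomial

variable {R S : Type*} [CommRing R] [CommRing S]

/-- The polynomial `∏ j ∈ s, (X + c - x j)`. -/
noncomputable def shiftedProd {M : ℕ} (x : Fin M → R) (c : R) (s : Finset (Fin M)) : R[X] :=
  ∏ j ∈ s, (X + C (c - x j))

lemma eval_shiftedProd {M : ℕ} (x : Fin M → R) (c z : R) (s : Finset (Fin M)) :
    (shiftedProd x c s).eval z = ∏ j ∈ s, (z + c - x j) := by
  simp [shiftedProd, eval_prod, add_sub_assoc]

lemma map_shiftedProd (f : R →+* S) {M : ℕ} (x : Fin M → R) (c : R) (s : Finset (Fin M)) :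
    (shiftedProd x c s).map f = shiftedProd (fun j => f (x j)) (f c) s := by
  simp [shiftedProd, Polynomial.map_prod]

lemma natDegree_shiftedProd_le {M : ℕ} (x : Fin M → R) (c : R) (s : Finset (Fin M)) :
    (shiftedProd x c s).natDegree ≤ #s := by
  refine (natDegree_prod_le _ _).trans ?_
  refine (Finset.sum_le_card_nsmul s _ 1 fun j _ => ?_).trans (by simp)
  exact natDegree_add_C.trans_le natDegree_X_le

/-- The polynomials `Q_k(X) Q_k(X + η)`, followed by the polynomials `Q_k(X) Q(X + η)`. -/
noncomputable def rowPoly {M : ℕ} (x : Fin M → R) (η : R) : Fin M ⊕ Fin M → R[X] :=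
  Sum.elim (fun k => shiftedProd x 0 (univ.erase k) * shiftedProd x η (univ.erase k))
    (fun k => shiftedProd x 0 (univ.erase k) * shiftedProd x η univ)

/-- The matrix of coefficients of the polynomials `rowPoly x η`. -/
noncomputable def coeffMatrix {M : ℕ} (x : Fin M → R) (η : R) :
    Matrix (Fin (M + M)) (Fin (M + M)) R :=
  Matrix.of fun i a => (rowPoly x η (finSumFinEquiv.symm i)).coeff a

lemma natDegree_rowPoly_lt {M : ℕ} (x : Fin M → R) (η : R) (i : Fin M ⊕ Fin M) :
    (rowPoly x η i).natDegree < M + M := by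
  have aux (k : Fin M) (s : Finset (Fin M)) :
      (shiftedProd x 0 (univ.erase k) * shiftedProd x η s).natDegree < M + M := by
    have h₀ := natDegree_mul_le (p := shiftedProd x 0 (univ.erase k)) (q := shiftedProd x η s)
    have h₁ := natDegree_shiftedProd_le x 0 (univ.erase k)
    have h₂ := natDegree_shiftedProd_le x η s
    have h₃ : #s ≤ M := by simpa using s.card_le_univ
    have h₄ : #(univ.erase k) = M - 1 := by simp
    have := k.pos
    omega
  rcases i with k | k <;> exact aux k _

lemma map_det_coeffMatrix (f : R →+* S) {M : ℕ} (x : Fin M → R) (η : R) :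
    f (coeffMatrix x η).det = (coeffMatrix (fun j => f (x j)) (f η)).det := by
  rw [RingHom.map_det]
  congr 1
  ext i a
  simp only [coeffMatrix, RingHom.mapMatrix_apply, Matrix.map_apply, Matrix.of_apply, ← coeff_map]
  congr 1
  rcases finSumFinEquiv.symm i with k | k <;> simp [rowPoly, map_shiftedProd]

/-- The points `x_k - η`, followed by the points `x_k`. -/
def nodes {M : ℕ} (x : Fin M → R) (η : R) : Fin (M + M) → R :=
  Fin.append (fun k => x k - η) x

lemma coeffMatrix_mul_vandermonde_transpose {M : ℕ} (x : Fin M → R) (η : R) (i j : Fin (M + M)) :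
    (coeffMatrix x η * (Matrix.vandermonde (nodes x η)).transpose) i j =
      (rowPoly x η (finSumFinEquiv.symm i)).eval (nodes x η j) := by
  rw [eval_eq_sum_range' (natDegree_rowPoly_lt x η _), Finset.sum_range]
  simp [Matrix.mul_apply, coeffMatrix, Matrix.vandermonde_apply]

lemma det_coeffMatrix_mul_det_vandermonde {M : ℕ} (x : Fin M → R) (η : R) :
    (coeffMatrix x η).det * (Matrix.vandermonde (nodes x η)).det =
      (∏ k, (∏ j ∈ univ.erase k, (x k - η - x j)) * ∏ j ∈ univ.erase k, (x k - x j)) *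
        ∏ k, (∏ j ∈ univ.erase k, (x k - x j)) * (η * ∏ j ∈ univ.erase k, (x k + η - x j)) := by
  rw [← Matrix.det_transpose (Matrix.vandermonde _), ← Matrix.det_mul,
    ← Matrix.det_submatrix_equiv_self finSumFinEquiv]
  have hz (k l : Fin M) (h : l ≠ k) : ∏ j ∈ univ.erase k, (x l - x j) = 0 :=
    Finset.prod_eq_zero (mem_erase.2 ⟨h, mem_univ l⟩) (sub_self _)
  have hblocks : (coeffMatrix x η * (Matrix.vandermonde (nodes x η)).transpose).submatrix
      finSumFinEquiv finSumFinEquiv = Matrix.fromBlocks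
        (Matrix.diagonal fun k =>
          (∏ j ∈ univ.erase k, (x k - η - x j)) * ∏ j ∈ univ.erase k, (x k - x j))
        (Matrix.diagonal fun k =>
          (∏ j ∈ univ.erase k, (x k - x j)) * ∏ j ∈ univ.erase k, (x k + η - x j))
        0
        (Matrix.diagonal fun k =>
          (∏ j ∈ univ.erase k, (x k - x j)) * (η * ∏ j ∈ univ.erase k, (x k + η - x j))) := by
    ext i l
    rw [Matrix.submatrix_apply, coeffMatrix_mul_vandermonde_transpose, Equiv.symm_apply_apply]
    rcases i with k | k <;> rcases l with l | l
    · rcases eq_or_ne l k with rfl | h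
      · simp [-Fin.natAdd_eq_addNat, rowPoly, nodes, eval_shiftedProd]
      · simp [-Fin.natAdd_eq_addNat, rowPoly, nodes, eval_shiftedProd, hz k l h, h.symm]
    · rcases eq_or_ne l k with rfl | h
      · simp [-Fin.natAdd_eq_addNat, rowPoly, nodes, eval_shiftedProd]
      · simp [-Fin.natAdd_eq_addNat, rowPoly, nodes, eval_shiftedProd, hz k l h, h.symm]
    · have : ∏ j, (x l - x j) = 0 := Finset.prod_eq_zero (mem_univ l) (sub_self _)
      simp [-Fin.natAdd_eq_addNat, rowPoly, nodes, eval_shiftedProd, this]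
    · rcases eq_or_ne l k with rfl | h
      · simp [-Fin.natAdd_eq_addNat, rowPoly, nodes, eval_shiftedProd,
          ← Finset.mul_prod_erase univ _ (mem_univ l)]
      · simp [-Fin.natAdd_eq_addNat, rowPoly, nodes, eval_shiftedProd, hz k l h, h.symm]
  rw [hblocks, Matrix.det_fromBlocks_zero₂₁, Matrix.det_diagonal, Matrix.det_diagonal]

lemma prod_prod_Ioi_eq_prod_prod_ite {n : ℕ} (f : Fin n → Fin n → R) :
    ∏ i, ∏ j ∈ Ioi i, f i j = ∏ i, ∏ j, if i < j then f i j else 1 := by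
  refine prod_congr rfl fun i _ => ?_
  rw [← Finset.prod_filter]
  congr 1
  ext j
  simp

lemma det_vandermonde_nodes {M : ℕ} (x : Fin M → R) (η : R) :
    (Matrix.vandermonde (nodes x η)).det =
      (Matrix.vandermonde x).det ^ 2 * ∏ k, η * ∏ j ∈ univ.erase k, (x k + η - x j) := by
  have hcross : ∏ k, η * ∏ j ∈ univ.erase k, (x k + η - x j) =
      ∏ i, ∏ j, (x j - (x i - η)) := by
    rw [Finset.prod_comm]
    refine prod_congr rfl fun k _ => ?_
    rw [← Finset.mul_prod_erase univ _ (mem_univ k)]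
    congr 1
    · ring
    · exact prod_congr rfl fun j _ => by ring
  have hlt (i j : Fin M) : Fin.castAdd M i < Fin.natAdd M j := by
    simp only [Fin.lt_def, Fin.val_castAdd, Fin.val_natAdd]; omega
  have hleft (i j : Fin M) : Fin.castAdd M i < Fin.castAdd M j ↔ i < j := Iff.rfl
  rw [hcross, Matrix.det_vandermonde, Matrix.det_vandermonde, prod_prod_Ioi_eq_prod_prod_ite,
    prod_prod_Ioi_eq_prod_prod_ite, Fin.prod_univ_add]
  simp only [Fin.prod_univ_add, nodes, Fin.append_left, Fin.append_right, hlt, if_true,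
    (hlt _ _).not_gt, if_false, prod_const_one, one_mul, prod_mul_distrib, sub_sub_sub_cancel_right,
    Fin.natAdd_lt_natAdd_iff, hleft]
  ring

lemma prod_prod_erase_eq_prod_prod_Ioi {n : ℕ} (f : Fin n → Fin n → R) :
    ∏ i, ∏ j ∈ univ.erase i, f j i = ∏ i, ∏ j ∈ Ioi i, f j i * f i j := by
  rw [Finset.prod_prod_Ioi_mul_eq_prod_prod_off_diag]
  simp only [Finset.compl_singleton]

lemma prod_prod_erase_sub_eq {M : ℕ} (x : Fin M → R) :
    ∏ k, ∏ j ∈ univ.erase k, (x k - x j) =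
      (-1) ^ (M * (M - 1) / 2) * (Matrix.vandermonde x).det ^ 2 := by
  have hcard : ∑ i : Fin M, #(Ioi i) = M * (M - 1) / 2 := by
    simp only [Fin.card_Ioi]
    rw [← Finset.sum_range_id, ← Finset.sum_range_reflect, Finset.sum_range]
  rw [prod_prod_erase_eq_prod_prod_Ioi fun j k => x k - x j, Matrix.det_vandermonde, ← hcard,
    ← Finset.prod_pow_eq_pow_sum, ← Finset.prod_pow, ← Finset.prod_mul_distrib]
  refine prod_congr rfl fun i _ => ?_
  rw [← Finset.prod_const, ← Finset.prod_pow, ← Finset.prod_mul_distrib]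
  exact prod_congr rfl fun j _ => by ring

lemma prod_prod_erase_sub_shift {M : ℕ} (x : Fin M → R) (η : R) :
    ∏ k, ∏ j ∈ univ.erase k, (x k - η - x j) = ∏ k, ∏ j ∈ univ.erase k, (x k + η - x j) := by
  rw [prod_prod_erase_eq_prod_prod_Ioi fun j k => x k - η - x j,
    prod_prod_erase_eq_prod_prod_Ioi fun j k => x k + η - x j]
  exact prod_congr rfl fun i _ => prod_congr rfl fun j _ => by ring

lemma det_coeffMatrix_of_injective [IsDomain R] {M : ℕ} (x : Fin M → R) (η : R)
    (h : Function.Injective (nodes x η)) :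
    (coeffMatrix x η).det = (-1) ^ (M * (M - 1) / 2) *
      ∏ k, (∏ j ∈ univ.erase k, (x k - x j)) * ∏ j ∈ univ.erase k, (x k + η - x j) := by
  refine mul_right_cancel₀ (Matrix.det_vandermonde_ne_zero_iff.2 h) ?_
  rw [det_coeffMatrix_mul_det_vandermonde, det_vandermonde_nodes]
  simp only [prod_mul_distrib]
  rw [prod_prod_erase_sub_shift, prod_prod_erase_sub_eq]
  ring

lemma nodes_mvPolynomial_injective (M : ℕ) :
    Function.Injective (nodes (fun k : Fin M => (MvPolynomial.X (some k) :
      MvPolynomial (Option (Fin M)) ℤ)) (MvPolynomial.X none)) := by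
  let e : MvPolynomial (Option (Fin M)) ℤ →+* ℤ :=
    MvPolynomial.eval fun o => o.elim (-(M : ℤ)) fun k => (k : ℤ)
  have he (i : Fin (M + M)) : e (nodes (fun k : Fin M => (MvPolynomial.X (some k) :
      MvPolynomial (Option (Fin M)) ℤ)) (MvPolynomial.X none) i) =
        nodes (fun k : Fin M => (k : ℤ)) (-(M : ℤ)) i := by
    refine Fin.addCases (fun k => ?_) (fun k => ?_) i <;> simp [-Fin.natAdd_eq_addNat, e, nodes]
  have hinj : Function.Injective (nodes (fun k : Fin M => (k : ℤ)) (-(M : ℤ))) := by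
    intro i j
    refine Fin.addCases (fun k => ?_) (fun k => ?_) i <;>
      refine Fin.addCases (fun l => ?_) (fun l => ?_) j <;>
      simp only [nodes, Fin.append_left, Fin.append_right, Fin.ext_iff, Fin.val_castAdd,
        Fin.val_natAdd] <;> omega
  intro i j hij
  exact hinj (by rw [← he, ← he, hij])

theorem det_coeffMatrix {M : ℕ} (x : Fin M → R) (η : R) :
    (coeffMatrix x η).det = (-1) ^ (M * (M - 1) / 2) *
      ∏ k, (∏ j ∈ univ.erase k, (x k - x j)) * ∏ j ∈ univ.erase k, (x k + η - x j) := by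
  let f : MvPolynomial (Option (Fin M)) ℤ →+* R :=
    MvPolynomial.eval₂Hom (Int.castRingHom R) fun o => o.elim η x
  have h := congrArg f (det_coeffMatrix_of_injective _ _ (nodes_mvPolynomial_injective M))
  rw [map_det_coeffMatrix] at h
  simpa [f] using h

end CoefficientMatrix

theorem statement8 (M : ℕ) (η : ℂ) (x : Fin M → ℂ)
    (C : Matrix (Fin (M + M)) (Fin (M + M)) ℂ)
    (hC1 : ∀ (k : Fin M) (z : ℂ),
      (∏ j ∈ Finset.univ.erase k, (z - x j)) *
          (∏ j ∈ Finset.univ.erase k, (z + η - x j))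
        = ∑ a, C (Fin.castAdd M k) a * z ^ (a : ℕ))
    (hC2 : ∀ (k : Fin M) (z : ℂ),
      (∏ j ∈ Finset.univ.erase k, (z - x j)) * (∏ j, (z + η - x j))
        = ∑ a, C (Fin.natAdd M k) a * z ^ (a : ℕ)) :
    C.det = (-1 : ℂ) ^ (M * (M - 1) / 2) *
      ∏ k, (∏ j ∈ Finset.univ.erase k, (x k - x j)) *
        (∏ j ∈ Finset.univ.erase k, (x k + η - x j)) := by
  have hrow (i : Fin (M + M)) : rowPoly x η (finSumFinEquiv.symm i) =
      ∑ a, Polynomial.C (C i a) * Polynomial.X ^ (a : ℕ) := by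
    refine Polynomial.funext fun z => ?_
    refine Fin.addCases (fun k => ?_) (fun k => ?_) i
    · simpa [-Fin.natAdd_eq_addNat, rowPoly, eval_shiftedProd,
        Polynomial.eval_finsetSum] using hC1 k z
    · simpa [-Fin.natAdd_eq_addNat, rowPoly, eval_shiftedProd,
        Polynomial.eval_finsetSum] using hC2 k z
  have hC : C = coeffMatrix x η := by
    ext i a
    simp [coeffMatrix, hrow, Polynomial.coeff_X_pow, Fin.val_inj]
  rw [hC, det_coeffMatrix]
end

section
/- For every λ ∈ ℂ, the antiperiodic transfer matrix commutes with S^x = Σ_{n=1}^{N} σ^x_n and with Γ^x = ⊗_{n=1}^{N} σ^x: [S^x, 𝒯(λ)] = 0 and [Γ^x, 𝒯(λ)] = 0, where σ^x_n acts as σ^x = [[0,1],[1,0]] on the n-th factor of 𝕍 and as the identity on the other factors. -/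
open Finset Matrix

/-- Spin configurations of the chain: `𝕍 = (ℂ²)^{⊗N}` is realized concretely as
`(Fin N → Fin 2) → ℂ`, functions on configurations. -/
abbrev Cfg (N : ℕ) := Fin N → Fin 2

/-- The rational `R`-matrix `R(λ) = λ·Id + η·P` on `ℂ² ⊗ ℂ²`, where `P` is the
permutation operator; in the standard basis this is
`[[λ+η,0,0,0],[0,λ,η,0],[0,η,λ,0],[0,0,0,λ+η]]`. -/
noncomputable def Rmat (η lam : ℂ) : Matrix (Fin 2 × Fin 2) (Fin 2 × Fin 2) ℂ :=
  Matrix.of fun p q =>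
    lam * (if p = q then 1 else 0) +
      η * (if p.1 = q.2 ∧ p.2 = q.1 then 1 else 0)

/-- `R_{0n}(λ)`: the `R`-matrix acting on the auxiliary space `V₀ = ℂ²` and the
`n`-th local quantum space, and as the identity on the other factors. -/
noncomputable def R0n {N : ℕ} (η lam : ℂ) (n : Fin N) :
    Matrix (Fin 2 × Cfg N) (Fin 2 × Cfg N) ℂ :=
  Matrix.of fun p q =>
    Rmat η lam (p.1, p.2 n) (q.1, q.2 n) *
      ∏ m ∈ Finset.univ.erase n, (if p.2 m = q.2 m then (1 : ℂ) else 0)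

/-- The monodromy matrix `T₀(λ) = R_{0N}(λ-ξ_N) ⋯ R_{01}(λ-ξ_1)` acting on
`V₀ ⊗ 𝕍`. -/
noncomputable def Tmono {N : ℕ} (η : ℂ) (ξ : Fin N → ℂ) (lam : ℂ) :
    Matrix (Fin 2 × Cfg N) (Fin 2 × Cfg N) ℂ :=
  (List.ofFn fun k : Fin N => R0n η (lam - ξ k.rev) k.rev).prod

/-- The operator `A(λ)` on `𝕍` (entry `(0,0)` of `T₀(λ)` in the auxiliary space). -/
noncomputable def Aop {N : ℕ} (η : ℂ) (ξ : Fin N → ℂ) (lam : ℂ) :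
    Matrix (Cfg N) (Cfg N) ℂ :=
  Matrix.of fun s t => Tmono η ξ lam (0, s) (0, t)

/-- The operator `B(λ)` on `𝕍` (entry `(0,1)` of `T₀(λ)` in the auxiliary space). -/
noncomputable def Bop {N : ℕ} (η : ℂ) (ξ : Fin N → ℂ) (lam : ℂ) :
    Matrix (Cfg N) (Cfg N) ℂ :=
  Matrix.of fun s t => Tmono η ξ lam (0, s) (1, t)

/-- The operator `C(λ)` on `𝕍` (entry `(1,0)` of `T₀(λ)` in the auxiliary space). -/
noncomputable def Cop {N : ℕ} (η : ℂ) (ξ : Fin N → ℂ) (lam : ℂ) :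
    Matrix (Cfg N) (Cfg N) ℂ :=
  Matrix.of fun s t => Tmono η ξ lam (1, s) (0, t)

/-- The operator `D(λ)` on `𝕍` (entry `(1,1)` of `T₀(λ)` in the auxiliary space). -/
noncomputable def Dop {N : ℕ} (η : ℂ) (ξ : Fin N → ℂ) (lam : ℂ) :
    Matrix (Cfg N) (Cfg N) ℂ :=
  Matrix.of fun s t => Tmono η ξ lam (1, s) (1, t)

/-- The antiperiodic transfer matrix `𝒯(λ) = tr₀(σ^x₀ T₀(λ)) = B(λ) + C(λ)`. -/
noncomputable def Ttransfer {N : ℕ} (η : ℂ) (ξ : Fin N → ℂ) (lam : ℂ) :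
    Matrix (Cfg N) (Cfg N) ℂ :=
  Bop η ξ lam + Cop η ξ lam

/-- `a(λ) = ∏_{n=1}^{N} (λ - ξ_n + η)`. -/
noncomputable def aFun {N : ℕ} (η : ℂ) (ξ : Fin N → ℂ) (lam : ℂ) : ℂ :=
  ∏ n, (lam - ξ n + η)

/-- `d(λ) = ∏_{n=1}^{N} (λ - ξ_n)`. -/
noncomputable def dFun {N : ℕ} (ξ : Fin N → ℂ) (lam : ℂ) : ℂ :=
  ∏ n, (lam - ξ n)

/-- The Pauli matrix `σ^x = [[0,1],[1,0]]`. -/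
noncomputable def sigmaX : Matrix (Fin 2) (Fin 2) ℂ :=
  Matrix.of fun i j => if i ≠ j then 1 else 0

/-- `σ^x_n`: the Pauli matrix `σ^x` acting on the `n`-th factor of `𝕍` and as
the identity on the other factors. -/
noncomputable def sigmaXn {N : ℕ} (n : Fin N) : Matrix (Cfg N) (Cfg N) ℂ :=
  Matrix.of fun s t =>
    sigmaX (s n) (t n) *
      ∏ m ∈ Finset.univ.erase n, (if s m = t m then (1 : ℂ) else 0)

/-- `S^x = Σ_{n=1}^{N} σ^x_n`. -/
noncomputable def SxOp (N : ℕ) : Matrix (Cfg N) (Cfg N) ℂ :=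
  ∑ n, sigmaXn n

/-- `Γ^x = ⊗_{n=1}^{N} σ^x`. -/
noncomputable def GxOp (N : ℕ) : Matrix (Cfg N) (Cfg N) ℂ :=
  Matrix.of fun s t => ∏ n, sigmaX (s n) (t n)

open scoped Kronecker

/-- The matrix of the substitution `v ↦ v ∘ f`. -/
def substMatrix {α : Type*} [DecidableEq α] (f : α → α) : Matrix α α ℂ :=
  Matrix.of fun p q => if f p = q then 1 else 0

theorem substMatrix_mul {α : Type*} [Fintype α] [DecidableEq α] (f g : α → α) :
    substMatrix f * substMatrix g = substMatrix (g ∘ f) := by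
  ext p q
  rw [Matrix.mul_apply, Finset.sum_eq_single (f p)]
  · simp [substMatrix]
  · intro j _ hj
    simp [substMatrix, hj.symm]
  · simp

/-- Exchange of the auxiliary spin with the spin at site `n`. -/
def swapAux {N : ℕ} (n : Fin N) (p : Fin 2 × Cfg N) : Fin 2 × Cfg N :=
  (p.2 n, Function.update p.2 n p.1)

/-- Flip of the auxiliary spin. -/
def flipAux {N : ℕ} (p : Fin 2 × Cfg N) : Fin 2 × Cfg N :=
  (p.1 + 1, p.2)

/-- Flip of the spin at site `n`. -/
def flipSite {N : ℕ} (n : Fin N) (p : Fin 2 × Cfg N) : Fin 2 × Cfg N :=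
  (p.1, Function.update p.2 n (p.2 n + 1))

/-- Flip of all spins, the auxiliary one included. -/
def flipAll {N : ℕ} (p : Fin 2 × Cfg N) : Fin 2 × Cfg N :=
  (p.1 + 1, fun m => p.2 m + 1)

theorem update_eq_iff_forall_ne {N : ℕ} (s t : Cfg N) (n : Fin N) (a : Fin 2) :
    Function.update s n a = t ↔ a = t n ∧ ∀ m ∈ univ.erase n, s m = t m := by
  simp [Function.update_eq_iff]

theorem sigmaX_apply (i j : Fin 2) : sigmaX i j = if i + 1 = j then 1 else 0 := by
  fin_cases i <;> fin_cases j <;> simp [sigmaX]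

theorem R0n_eq {N : ℕ} (η lam : ℂ) (n : Fin N) :
    R0n η lam n = lam • 1 + η • substMatrix (swapAux n) := by
  ext ⟨a, s⟩ ⟨b, t⟩
  have h : s = t ↔ s n = t n ∧ ∀ m ∈ univ.erase n, s m = t m := by
    simpa using update_eq_iff_forall_ne s t n (s n)
  simp only [R0n, Rmat, substMatrix, swapAux, Matrix.of_apply, Matrix.add_apply,
    Matrix.smul_apply, Matrix.one_apply, Prod.mk.injEq, h, update_eq_iff_forall_ne,
    Finset.prod_ite_zero, Finset.prod_const_one, smul_eq_mul]
  by_cases hm : ∀ m ∈ univ.erase n, s m = t m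
  · simp only [eq_true hm, if_true, and_true, mul_one, true_and,
      and_comm (a := a = t n)]
  · simp only [eq_false hm, if_false, and_false, mul_zero, add_zero]

theorem sigmaX_kronecker_one (N : ℕ) :
    sigmaX ⊗ₖ (1 : Matrix (Cfg N) (Cfg N) ℂ) = substMatrix flipAux := by
  ext ⟨a, s⟩ ⟨b, t⟩
  simp [substMatrix, flipAux, sigmaX_apply, Matrix.one_apply, ← ite_and, and_comm]

theorem one_kronecker_sigmaXn {N : ℕ} (n : Fin N) :
    (1 : Matrix (Fin 2) (Fin 2) ℂ) ⊗ₖ sigmaXn n = substMatrix (flipSite n) := by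
  ext ⟨a, s⟩ ⟨b, t⟩
  simp only [substMatrix, flipSite, sigmaXn, kroneckerMap_apply, Matrix.of_apply,
    sigmaX_apply, Matrix.one_apply, Prod.mk.injEq, update_eq_iff_forall_ne,
    Finset.prod_ite_zero, Finset.prod_const_one, ite_and, mul_ite, mul_one, mul_zero]
  split_ifs <;> rfl

theorem sigmaX_kronecker_GxOp (N : ℕ) :
    sigmaX ⊗ₖ GxOp N = substMatrix flipAll := by
  ext ⟨a, s⟩ ⟨b, t⟩
  simp only [substMatrix, flipAll, GxOp, kroneckerMap_apply, Matrix.of_apply,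
    sigmaX_apply, Prod.mk.injEq, funext_iff,
    Finset.prod_ite_zero, Finset.prod_const_one, Finset.mem_univ, true_imp_iff, ite_and,
    mul_ite, mul_one, mul_zero]
  split_ifs <;> rfl

theorem swapAux_comp_flipAux {N : ℕ} (n : Fin N) :
    swapAux n ∘ flipAux = flipSite n ∘ swapAux n := by
  funext p
  simp [swapAux, flipAux, flipSite]

theorem swapAux_comp_flipSite {N : ℕ} (n : Fin N) :
    swapAux n ∘ flipSite n = flipAux ∘ swapAux n := by
  funext p
  simp [swapAux, flipAux, flipSite]

theorem swapAux_comp_flipSite_of_ne {N : ℕ} {n m : Fin N} (h : m ≠ n) :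
    swapAux n ∘ flipSite m = flipSite m ∘ swapAux n := by
  funext p
  simp [swapAux, flipSite, h, h.symm, Function.update_comm h]

theorem swapAux_comp_flipAll {N : ℕ} (n : Fin N) :
    swapAux n ∘ flipAll = flipAll ∘ swapAux n := by
  funext p
  refine Prod.ext rfl (funext fun m => ?_)
  by_cases h : m = n
  · subst h; simp [swapAux, flipAll]
  · simp [swapAux, flipAll, h]

theorem commute_R0n {N : ℕ} {η lam : ℂ} {n : Fin N}
    {K : Matrix (Fin 2 × Cfg N) (Fin 2 × Cfg N) ℂ}
    (h : Commute K (substMatrix (swapAux n))) : Commute K (R0n η lam n) := by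
  rw [R0n_eq]
  exact ((Commute.one_right K).smul_right lam).add_right (h.smul_right η)

theorem commute_Tmono {N : ℕ} (η : ℂ) (ξ : Fin N → ℂ) (lam : ℂ)
    {K : Matrix (Fin 2 × Cfg N) (Fin 2 × Cfg N) ℂ}
    (h : ∀ n : Fin N, Commute K (substMatrix (swapAux n))) :
    Commute K (Tmono η ξ lam) := by
  refine Commute.list_prod_right _ _ fun M hM => ?_
  obtain ⟨k, rfl⟩ := (List.mem_ofFn' _ _).mp hM
  exact commute_R0n (h _)

theorem commute_flipAll_swapAux {N : ℕ} (n : Fin N) :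
    Commute (substMatrix flipAll) (substMatrix (swapAux n)) := by
  rw [Commute, SemiconjBy, substMatrix_mul, substMatrix_mul, swapAux_comp_flipAll]

theorem commute_sum_flips_swapAux {N : ℕ} (n : Fin N) :
    Commute (substMatrix flipAux + ∑ m, substMatrix (flipSite m))
      (substMatrix (swapAux n)) := by
  rw [← Finset.add_sum_erase _ _ (Finset.mem_univ n), ← add_assoc]
  refine Commute.add_left ?_ (Commute.sum_left _ _ _ fun m hm => ?_)
  · rw [Commute, SemiconjBy, add_mul, mul_add]
    simp only [substMatrix_mul, swapAux_comp_flipAux, swapAux_comp_flipSite]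
    exact add_comm _ _
  · rw [Commute, SemiconjBy, substMatrix_mul, substMatrix_mul,
      swapAux_comp_flipSite_of_ne (Finset.ne_of_mem_erase hm)]

theorem commute_total_spin_Tmono {N : ℕ} (η : ℂ) (ξ : Fin N → ℂ) (lam : ℂ) :
    Commute (sigmaX ⊗ₖ (1 : Matrix (Cfg N) (Cfg N) ℂ) +
      (1 : Matrix (Fin 2) (Fin 2) ℂ) ⊗ₖ SxOp N) (Tmono η ξ lam) := by
  have h : (1 : Matrix (Fin 2) (Fin 2) ℂ) ⊗ₖ SxOp N =
      ∑ m, substMatrix (flipSite m) := by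
    simp only [← one_kronecker_sigmaXn]
    ext p q
    simp [SxOp, Matrix.sum_apply, Finset.mul_sum]
  rw [h, sigmaX_kronecker_one]
  exact commute_Tmono η ξ lam commute_sum_flips_swapAux

theorem commute_total_flip_Tmono {N : ℕ} (η : ℂ) (ξ : Fin N → ℂ) (lam : ℂ) :
    Commute (sigmaX ⊗ₖ GxOp N) (Tmono η ξ lam) := by
  rw [sigmaX_kronecker_GxOp]
  exact commute_Tmono η ξ lam commute_flipAll_swapAux

theorem statement14 (N : ℕ) (hN : 1 ≤ N) (η : ℂ) (hη : η ≠ 0)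
    (ξ : Fin N → ℂ) :
    ∀ lam : ℂ,
      SxOp N * Ttransfer η ξ lam = Ttransfer η ξ lam * SxOp N ∧
      GxOp N * Ttransfer η ξ lam = Ttransfer η ξ lam * GxOp N := by
  intro lam
  constructor
  · ext s t
    have h01 := congr_fun₂ (commute_total_spin_Tmono η ξ lam).eq (0, s) (1, t)
    have h10 := congr_fun₂ (commute_total_spin_Tmono η ξ lam).eq (1, s) (0, t)
    simp [add_mul, mul_add, Matrix.mul_apply, Fintype.sum_prod_type, sigmaX,
      Matrix.one_apply, Finset.sum_add_distrib] at h01 h10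
    simp only [Ttransfer, Bop, Cop, add_mul, mul_add, Matrix.add_apply, Matrix.mul_apply,
      Matrix.of_apply, Finset.sum_add_distrib]
    linear_combination h01 + h10
  · ext s t
    have h00 := congr_fun₂ (commute_total_flip_Tmono η ξ lam).eq (0, s) (0, t)
    have h11 := congr_fun₂ (commute_total_flip_Tmono η ξ lam).eq (1, s) (1, t)
    simp [Matrix.mul_apply, Fintype.sum_prod_type, sigmaX] at h00 h11
    simp only [Ttransfer, Bop, Cop, add_mul, mul_add, Matrix.add_apply, Matrix.mul_apply,
      Matrix.of_apply, Finset.sum_add_distrib]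
    linear_combination h00 + h11
end
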